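/- arXiv:1105.2399 — 2 statements merged into one kernel-verified Lean document; each statement's English description precedes it below -/
import Mathlib

section
/- Let (R, m) be a Noetherian local ring, N an R-module, and M a finitely generated R-module with depth_R(M) = 0. If Ext_R^j(R/m, N) ≠ 0 for some j and Ext_R^i(R/m, N) = 0 for all i > j, then Ext_R^j(M, N) ≠ 0. -/
open CategoryTheory IsLocalRing

noncomputable section

variable (R : Type) [CommRing R]

/-- The Ext group `Ext_R^i(M, N)` for `R`-modules, as an `R`-module. -/
abbrev ext (i : ℕ) (M N : Type) [AddCommGroup M] [Module R M]
    [AddCommGroup N] [Module R N] : ModuleCat R :=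
  ((Ext R (ModuleCat R) i).obj (Opposite.op (ModuleCat.of R M))).obj (ModuleCat.of R N)

/-- The depth of a module over a local ring: the supremum of lengths of
regular `M`-sequences with entries in the maximal ideal. -/
def depth [IsLocalRing R] (M : Type) [AddCommGroup M] [Module R M] : ℕ∞ :=
  sSup {n : ℕ∞ | ∃ rs : List R, (∀ x ∈ rs, x ∈ maximalIdeal R) ∧
    RingTheory.Sequence.IsRegular M rs ∧ (rs.length : ℕ∞) = n}

/-- The injective dimension of a module: the least `n` such that `M` admits an
injective resolution vanishing in degrees `> n`. -/
def injDim (M : Type) [AddCommGroup M] [Module R M] : ℕ∞ :=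
  sInf {n : ℕ∞ | ∃ I : InjectiveResolution (ModuleCat.of R M),
    ∀ i : ℕ, n < (i : ℕ∞) → Limits.IsZero (I.cocomplex.X i)}

/-- `sup{ i | Ext_R^i(M, N) ≠ 0 }` as an element of `ℕ∞`. -/
def extSup (M N : Type) [AddCommGroup M] [Module R M]
    [AddCommGroup N] [Module R N] : ℕ∞ :=
  sSup {n : ℕ∞ | ∃ i : ℕ, (i : ℕ∞) = n ∧ Nontrivial (ext R i M N)}

/-- A submodule is essential if it meets every nonzero submodule nontrivially;
`f : N →ₗ[R] E` realizes `E` as an injective hull of `N` if `E` is injective and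
`f` is an injective map with essential image. -/
def IsInjectiveHull (N E : Type) [AddCommGroup N] [Module R N]
    [AddCommGroup E] [Module R E] : Prop :=
  Module.Injective R E ∧ ∃ f : N →ₗ[R] E, Function.Injective f ∧
    ∀ S : Submodule R E, S ≠ ⊥ → LinearMap.range f ⊓ S ≠ ⊥

/-- `c` is the `i`-th Bass number `μ^i(𝔪, M)`: the dimension over the residue
field of `Ext_R^i(R/𝔪, M)`. -/
def IsBassNumberAtMax [IsLocalRing R] (i : ℕ) (M : Type) [AddCommGroup M] [Module R M]
    (c : Cardinal) : Prop :=
  ∃ ι : Type, Cardinal.mk ι = c ∧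
    Nonempty ((ext R i (ResidueField R) M) ≃ₗ[R] (ι →₀ ResidueField R))

/-- Vanishing of the derived functor `Ext_R^n(A, B)` agrees with vanishing of the group of
shifted morphisms in the derived category. -/
theorem subsingleton_ext_iff (n : ℕ) (A B : Type) [AddCommGroup A] [Module R A]
    [AddCommGroup B] [Module R B] :
    Subsingleton (ext R n A B) ↔
      Subsingleton (Abelian.Ext.{0} (ModuleCat.of R A) (ModuleCat.of R B) n) := by
  let P := projectiveResolution (ModuleCat.of R A)
  have hext : Subsingleton (ext R n A B) ↔
      ∀ f : P.complex.X n ⟶ ModuleCat.of R B, P.complex.d (n + 1) n ≫ f = 0 →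
        ∃ g : P.complex.X ((ComplexShape.up ℕ).prev n) ⟶ ModuleCat.of R B,
          P.complex.d n _ ≫ g = f := by
    rw [← ModuleCat.isZero_iff_subsingleton, (P.isoExt n (ModuleCat.of R B)).isZero_iff,
      ← HomologicalComplex.exactAt_iff_isZero_homology,
      HomologicalComplex.exactAt_iff' _ _ n (n + 1) rfl (by simp),
      ShortComplex.moduleCat_exact_iff]
    rfl
  rw [hext]
  cases n with
  | zero =>
    have hd : P.complex.d 0 ((ComplexShape.up ℕ).prev 0) = 0 :=
      P.complex.shape _ _ (by simp)
    simp only [hd, Limits.zero_comp]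
    rw [Abelian.Ext.addEquiv₀.toEquiv.subsingleton_congr]
    constructor
    · intro h
      refine ⟨fun f g ↦ ?_⟩
      have hπ (f : ModuleCat.of R A ⟶ ModuleCat.of R B) :
          P.complex.d (0 + 1) 0 ≫ P.π.f 0 ≫ f = 0 := by
        erw [← Category.assoc, P.complex_d_comp_π_f_zero, Limits.zero_comp]
      obtain ⟨-, hf⟩ := h (P.π.f 0 ≫ f) (hπ f)
      obtain ⟨-, hg⟩ := h (P.π.f 0 ≫ g) (hπ g)
      exact (cancel_epi (P.π.f 0)).1 (hf.symm.trans hg)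
    · intro h f hf
      have hdesc := P.isColimitCokernelCofork.fac (Limits.CokernelCofork.ofπ f hf)
        Limits.WalkingParallelPair.one
      rw [h.elim (P.isColimitCokernelCofork.desc (Limits.CokernelCofork.ofπ f hf)) 0] at hdesc
      exact ⟨0, by simpa using hdesc⟩
  | succ n =>
    rw [show (ComplexShape.up ℕ).prev (n + 1) = n by simp]
    constructor
    · intro h
      refine subsingleton_of_forall_eq 0 fun α ↦ ?_
      obtain ⟨f, hf, rfl⟩ := P.extMk_surjective α _ rfl
      exact (P.extMk_eq_zero_iff f _ rfl hf n rfl).2 (h f hf)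
    · intro h f hf
      exact (P.extMk_eq_zero_iff f _ rfl hf n rfl).1 (Subsingleton.elim _ _)

/-- A short exact sequence of linear maps is a short exact sequence in `ModuleCat R`. -/
theorem shortExact_of_exact {A B C : Type} [AddCommGroup A] [Module R A] [AddCommGroup B]
    [Module R B] [AddCommGroup C] [Module R C] (f : A →ₗ[R] B) (g : B →ₗ[R] C)
    (hf : Function.Injective f) (hg : Function.Surjective g) (hfg : Function.Exact f g) :
    (ModuleCat.shortComplexOfCompEqZero f g hfg.linearMap_comp_eq_zero).ShortExact where
  exact := ShortComplex.ShortExact.moduleCat_exact_iff_function_exact _ |>.2 hfg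
  mono_f := (ModuleCat.mono_iff_injective _).2 hf
  epi_g := (ModuleCat.epi_iff_surjective _).2 hg

/-- A nontrivial finite module of depth zero has no regular element in the maximal ideal. -/
theorem not_isSMulRegular_of_depth_eq_zero [IsLocalRing R] (M : Type) [AddCommGroup M] [Module R M]
    [Module.Finite R M] [Nontrivial M] (hM : depth R M = 0) {x : R} (hx : x ∈ maximalIdeal R) :
    ¬ IsSMulRegular M x := by
  intro hreg
  have hle : (1 : ℕ∞) ≤ depth R M := by
    refine le_sSup ⟨[x], by simpa using hx, ⟨?_, ?_⟩, by simp⟩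
    · exact (RingTheory.Sequence.isWeaklyRegular_singleton_iff M x).2 hreg
    · refine Submodule.top_ne_ideal_smul_of_le_jacobson_annihilator ?_
      refine le_trans ?_ (maximalIdeal_le_jacobson _)
      simpa [Ideal.ofList, Ideal.span_le] using hx
  simp [hM] at hle

variable [IsNoetherianRing R] [IsLocalRing R]

/-- If `Ext^i(R/𝔪, N) = 0`, then `Ext^i(A, N) = 0` for every finite module `A` killed by a power
of `𝔪`. -/
theorem subsingleton_ext_of_pow_le_annihilator (N : Type) [AddCommGroup N] [Module R N] {i : ℕ}
    (h : Subsingleton (Abelian.Ext.{0} (ModuleCat.of R (ResidueField R)) (ModuleCat.of R N) i))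
    (n : ℕ) (A : Type) [AddCommGroup A] [Module R A] [hA : Module.Finite R A]
    (hn : maximalIdeal R ^ n ≤ Module.annihilator R A) :
    Subsingleton (Abelian.Ext.{0} (ModuleCat.of R A) (ModuleCat.of R N) i) := by
  revert hn
  induction hA using IsNoetherianRing.induction_on_isQuotientEquivQuotientPrime R with
  | subsingleton A =>
    intro _
    have hz : Limits.IsZero (ModuleCat.of R A) := ModuleCat.isZero_of_subsingleton _
    refine subsingleton_of_forall_eq 0 fun x ↦ ?_
    rw [← Abelian.Ext.mk₀_id_comp x, hz.eq_of_src (𝟙 _) 0]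
    simp
  | quotient A p e =>
    intro hn
    have hp : p.1 = maximalIdeal R := by
      refine le_antisymm (le_maximalIdeal p.2.ne_top) ?_
      rw [e.annihilator_eq, Ideal.annihilator_quotient] at hn
      exact p.2.le_of_pow_le hn
    let e' : ModuleCat.of R A ≅ ModuleCat.of R (ResidueField R) :=
      (e.trans (Submodule.quotEquivOfEq _ _ hp)).toModuleIso
    refine subsingleton_of_forall_eq 0 fun x ↦ ?_
    rw [← Abelian.Ext.mk₀_id_comp x, ← e'.hom_inv_id, ← Abelian.Ext.mk₀_comp_mk₀_assoc,
      Subsingleton.elim ((Abelian.Ext.mk₀ e'.inv).comp x _) 0, Abelian.Ext.comp_zero]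
  | exact A B C f g hf hg hfg ihA ihC =>
    intro hn
    have hS := shortExact_of_exact R f g hf hg hfg
    have hA := ihA (hn.trans (f.annihilator_le_of_injective hf))
    have hC := ihC (hn.trans (g.annihilator_le_of_surjective hg))
    refine subsingleton_of_forall_eq 0 fun x ↦ ?_
    obtain ⟨y, rfl⟩ := Abelian.Ext.contravariant_sequence_exact₂ hS _ x (hA.elim _ _)
    rw [hC.elim y 0, Abelian.Ext.comp_zero]

/-- A nontrivial finite module of depth zero contains a copy of the residue field, which moreover
embeds in the quotient by a power of the maximal ideal. -/
theorem exists_residueField_injective_mkQ_comp (M : Type) [AddCommGroup M] [Module R M]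
    [Module.Finite R M] [Nontrivial M] (hM : depth R M = 0) :
    ∃ (φ : ResidueField R →ₗ[R] M) (n : ℕ), Function.Injective
      ((maximalIdeal R ^ n • (⊤ : Submodule R M)).mkQ ∘ₗ φ) := by
  have hann : Module.annihilator R (ResidueField R) = maximalIdeal R :=
    Ideal.annihilator_quotient
  have : Nontrivial (ResidueField R →ₗ[R] M) := by
    rw [← not_subsingleton_iff_nontrivial, IsSMulRegular.subsingleton_linearMap_iff, hann]
    rintro ⟨x, hx, hreg⟩
    exact not_isSMulRegular_of_depth_eq_zero R M hM hx hreg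
  obtain ⟨φ, hφ⟩ := exists_ne (0 : ResidueField R →ₗ[R] M)
  obtain ⟨a, ha⟩ : ∃ a, φ a ≠ 0 := by
    by_contra! h
    exact hφ (LinearMap.ext h)
  have hinf := Ideal.iInf_pow_smul_eq_bot_of_isLocalRing (M := M) (maximalIdeal R)
    (maximalIdeal.isMaximal R).ne_top
  obtain ⟨n, hn⟩ : ∃ n : ℕ, φ a ∉ (maximalIdeal R ^ n • ⊤ : Submodule R M) := by
    by_contra! h
    exact ha (by simpa [hinf] using (Submodule.mem_iInf _).2 h)
  have : IsSimpleModule R (ResidueField R) :=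
    isSimpleModule_iff_quot_maximal.2 ⟨maximalIdeal R, inferInstance, ⟨LinearEquiv.refl R _⟩⟩
  refine ⟨φ, n, (LinearMap.injective_or_eq_zero _).resolve_right fun h ↦ hn ?_⟩
  simpa using LinearMap.congr_fun h a

/-- If `depth M = 0`, `Ext^j(R/𝔪, N) ≠ 0` and `Ext^i(R/𝔪, N) = 0` for all `i > j`,
then `Ext^j(M, N) ≠ 0`. -/
theorem ext_ne_zero_of_depth_zero
    (M : Type) [AddCommGroup M] [Module R M] [Module.Finite R M] [Nontrivial M]
    (N : Type) [AddCommGroup N] [Module R N]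
    (hM : depth R M = 0) (j : ℕ)
    (hj : Nontrivial (ext R j (ResidueField R) N))
    (hvanish : ∀ i : ℕ, j < i → Subsingleton (ext R i (ResidueField R) N)) :
    Nontrivial (ext R j M N) := by
  rw [← not_subsingleton_iff_nontrivial, subsingleton_ext_iff] at hj ⊢
  intro hMN
  obtain ⟨φ, n, hφ⟩ := exists_residueField_injective_mkQ_comp R M hM
  set π := (maximalIdeal R ^ n • (⊤ : Submodule R M)).mkQ
  have hS := shortExact_of_exact R (π ∘ₗ φ) (LinearMap.range (π ∘ₗ φ)).mkQ hφ
    (Submodule.mkQ_surjective _) (LinearMap.exact_map_mkQ_range _)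
  have hn : maximalIdeal R ^ n ≤
      Module.annihilator R (M ⧸ (maximalIdeal R ^ n • (⊤ : Submodule R M))) := by
    intro r hr
    rw [Module.mem_annihilator]
    intro x
    obtain ⟨x, rfl⟩ := Submodule.mkQ_surjective _ x
    rw [← map_smul, Submodule.mkQ_apply, Submodule.Quotient.mk_eq_zero]
    exact Submodule.smul_mem_smul hr Submodule.mem_top
  have hC := subsingleton_ext_of_pow_le_annihilator R N
    ((subsingleton_ext_iff R _ _ _).1 (hvanish (1 + j) (by lia))) n
    (_ ⧸ LinearMap.range (π ∘ₗ φ))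
    (hn.trans (LinearMap.annihilator_le_of_surjective _ (Submodule.mkQ_surjective _)))
  refine hj (subsingleton_of_forall_eq 0 fun x ↦ ?_)
  obtain ⟨y, rfl⟩ := Abelian.Ext.contravariant_sequence_exact₁ hS _ x rfl (hC.elim _ _)
  change (Abelian.Ext.mk₀ (ModuleCat.ofHom φ ≫ ModuleCat.ofHom π)).comp y _ = 0
  rw [← Abelian.Ext.mk₀_comp_mk₀_assoc, hMN.elim ((Abelian.Ext.mk₀ (ModuleCat.ofHom π)).comp y _) 0,
    Abelian.Ext.comp_zero]


end
end

section
/- Let (R, m) be a Noetherian local ring, M a finitely generated R-module, N any R-module, x ∈ m regular on M, and r, s positive integers with s ≤ r. If Ext_R^i(M/xM, N) = 0 for all i > r - s + 1 and Ext_R^{r-s+1}(M/xM, N) ≠ 0, and Ext_R^i(M, N) is finitely generated for all i, then Ext_R^i(M, N) = 0 for all i > r - s and Ext_R^{r-s}(M, N) ≠ 0. -/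
open CategoryTheory IsLocalRing

noncomputable section

variable (R : Type) [CommRing R]

section ExtComparison

universe w v u t

namespace CategoryTheory.ProjectiveResolution

variable {C : Type u} [Category.{v} C] [Abelian C] {X Y : C} (P : ProjectiveResolution X)

lemma mem_ker_linearYonedaObj_g_iff (A : Type t) [Ring A] [Linear A C] {n : ℕ}
    (f : P.complex.X n ⟶ Y) :
    (f : (P.complex.linearYonedaObj A Y).X n) ∈
      LinearMap.ker ((P.complex.linearYonedaObj A Y).sc n).g.hom ↔
      P.complex.d (n + 1) n ≫ f = 0 := by
  rw [← CochainComplex.next ℕ n]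
  rfl

variable [HasExt.{w} C]

lemma smul_extMk {A : Type t} [Ring A] [Linear A C] {n : ℕ} (a : A) (f : P.complex.X n ⟶ Y)
    (m : ℕ) (hm : n + 1 = m) (hf : P.complex.d m n ≫ f = 0) :
    a • P.extMk f m hm hf = P.extMk (a • f) m hm (by simp [hf]) := by
  simp [Abelian.Ext.smul_eq_comp_mk₀, extMk_comp_mk₀]

lemma extMk_zero_eq_zero_iff (f : P.complex.X 0 ⟶ Y) (hf : P.complex.d 1 0 ≫ f = 0) :
    P.extMk f 1 rfl hf = 0 ↔ f = 0 := by
  simp only [← P.extEquivCohomologyClass.apply_eq_iff_eq,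
    extEquivCohomologyClass_extMk, extEquivCohomologyClass_zero,
    CochainComplex.HomComplex.CohomologyClass.mk_eq_zero_iff]
  rw [CochainComplex.HomComplex.Cocycle.toSingleMk_mem_coboundaries_iff _ _ _ _ _ 1 (by lia)]
  have h0 : Limits.IsZero (P.cochainComplex.X 1) :=
    CochainComplex.isZero_of_isStrictlyLE _ 0 _
  constructor
  · rintro ⟨g, hg⟩
    rw [h0.eq_of_src g 0, Limits.comp_zero] at hg
    rw [← cancel_epi (P.cochainComplexXIso (-(0 : ℕ)) 0 rfl).hom, ← hg, Limits.comp_zero]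
  · rintro rfl
    exact ⟨0, by simp⟩

variable (A : Type t) [Ring A] [Linear A C]

variable (Y) in
/-- Cocycles of `Hom(P, Y)` represent classes in `Ext X Y n`. -/
def cocyclesToExt (n : ℕ) :
    LinearMap.ker ((P.complex.linearYonedaObj A Y).sc n).g.hom →ₗ[A] Abelian.Ext X Y n where
  toFun f := P.extMk (n := n) (f.1 : P.complex.X n ⟶ Y) (n + 1) rfl
    ((P.mem_ker_linearYonedaObj_g_iff A _).1 f.2)
  map_add' _ _ := (P.add_extMk _ _ _ _ _ _).symm
  map_smul' a _ := (P.smul_extMk a _ _ _ _).symm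

lemma cocyclesToExt_surjective (n : ℕ) : Function.Surjective (P.cocyclesToExt Y A n) := by
  intro α
  obtain ⟨f, hf, rfl⟩ := P.extMk_surjective α (n + 1) rfl
  exact ⟨⟨f, (P.mem_ker_linearYonedaObj_g_iff A f).2 hf⟩, rfl⟩

lemma ker_cocyclesToExt (n : ℕ) : LinearMap.ker (P.cocyclesToExt Y A n) =
    LinearMap.range ((P.complex.linearYonedaObj A Y).sc n).moduleCatToCycles := by
  ext ⟨f, hf⟩
  have hf' := (P.mem_ker_linearYonedaObj_g_iff A f).1 hf
  have hrange : (⟨f, hf⟩ : LinearMap.ker ((P.complex.linearYonedaObj A Y).sc n).g.hom) ∈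
      LinearMap.range ((P.complex.linearYonedaObj A Y).sc n).moduleCatToCycles ↔
      ∃ g : P.complex.X ((ComplexShape.up ℕ).prev n) ⟶ Y,
        P.complex.d n ((ComplexShape.up ℕ).prev n) ≫ g = f :=
    exists_congr fun _ ↦ Subtype.ext_iff
  rw [hrange, LinearMap.mem_ker]
  cases n with
  | zero =>
    refine (P.extMk_zero_eq_zero_iff f hf').trans ?_
    rw [CochainComplex.prev_nat_zero, P.complex.shape _ _ (by simp)]
    simp only [Limits.zero_comp, exists_const]
    exact eq_comm
  | succ n =>
    refine (P.extMk_eq_zero_iff f _ rfl hf' n rfl).trans ?_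
    rw [CochainComplex.prev_nat_succ]

variable (Y) in
/-- The groups `Ext A C n` obtained by deriving `Hom` in its first argument agree with the
groups `Abelian.Ext` defined through the derived category. -/
def extLinearEquiv [EnoughProjectives C] (n : ℕ) :
    ((Ext A C n).obj (Opposite.op X)).obj Y ≃ₗ[A] Abelian.Ext X Y n :=
  (P.isoExt n Y ≪≫ ((P.complex.linearYonedaObj A Y).sc n).moduleCatHomologyIso).toLinearEquiv ≪≫ₗ
    Submodule.quotEquivOfEq _ _ (P.ker_cocyclesToExt A n).symm ≪≫ₗ
    (P.cocyclesToExt Y A n).quotKerEquivOfSurjective (P.cocyclesToExt_surjective A n)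

end CategoryTheory.ProjectiveResolution

end ExtComparison

section QuotSMulTop

universe v u

variable {A : Type u} [CommRing A] [Small.{v} A] {M N : ModuleCat.{v} A} {a : A} {n : ℕ}

lemma ModuleCat.mk₀_smulShortComplex_f_comp (a : A) (z : Abelian.Ext M N n) :
    (Abelian.Ext.mk₀ (M.smulShortComplex a).f).comp z (zero_add n) = a • z := by
  have h : (Abelian.Ext.mk₀ (a • 𝟙 M)).comp z (zero_add n) = a • z := by
    simp [Abelian.Ext.mk₀_smul]
  exact h

/-- If `a` is `M`-regular and `Ext^{n+1}(M/aM, N) = 0`, then `a` acts surjectively on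
`Ext^n(M, N)`, so the latter vanishes by Nakayama's lemma. -/
theorem IsSMulRegular.subsingleton_ext_of_succ [IsLocalRing A] (hreg : IsSMulRegular M a)
    (ha : a ∈ maximalIdeal A) (hfg : Module.Finite A (Abelian.Ext M N n))
    (hvanish : Subsingleton (Abelian.Ext (M.smulShortComplex a).X₃ N (n + 1))) :
    Subsingleton (Abelian.Ext M N n) := by
  rw [← Submodule.subsingleton_iff A, ← subsingleton_iff_bot_eq_top]
  refine (Submodule.eq_bot_of_le_smul_of_le_jacobson_bot (maximalIdeal A) _ hfg.fg_top
    (fun y _ ↦ ?_) (maximalIdeal_le_jacobson _)).symm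
  obtain ⟨z, rfl⟩ := Abelian.Ext.contravariant_sequence_exact₁ hreg.smulShortComplex_shortExact
    N y (add_comm 1 n) (Subsingleton.elim _ _)
  exact Set.mem_of_eq_of_mem (ModuleCat.mk₀_smulShortComplex_f_comp a z)
    (Submodule.smul_mem_smul ha trivial)

/-- If `a` is `M`-regular and `Ext^{n+1}(M, N) = 0`, then `Ext^n(M, N)` surjects onto
`Ext^{n+1}(M/aM, N)`. -/
theorem IsSMulRegular.nontrivial_ext_of_succ (hreg : IsSMulRegular M a)
    (hvanish : Subsingleton (Abelian.Ext M N (n + 1)))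
    (hne : Nontrivial (Abelian.Ext (M.smulShortComplex a).X₃ N (n + 1))) :
    Nontrivial (Abelian.Ext M N n) := by
  by_contra h
  rw [not_nontrivial_iff_subsingleton] at h
  obtain ⟨y, hy⟩ := exists_ne (0 : Abelian.Ext (M.smulShortComplex a).X₃ N (n + 1))
  obtain ⟨z, rfl⟩ := Abelian.Ext.contravariant_sequence_exact₃ hreg.smulShortComplex_shortExact
    N y (Subsingleton.elim (α := Abelian.Ext M N (n + 1)) _ _) (add_comm 1 n)
  obtain rfl : z = 0 := Subsingleton.elim (α := Abelian.Ext M N n) _ _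
  exact hy (Abelian.Ext.comp_zero ..)

end QuotSMulTop

variable [IsNoetherianRing R] [IsLocalRing R]


/-- Inductive step of the generalized Ischebeck formula: if `x` is `M`-regular,
`Ext^i(M/xM, N) = 0` for `i > r - s + 1`, `Ext^{r-s+1}(M/xM, N) ≠ 0` and all
`Ext^i(M, N)` are finitely generated, then `Ext^i(M, N) = 0` for `i > r - s` and
`Ext^{r-s}(M, N) ≠ 0`. -/
theorem ischebeck_inductive_step
    (M : Type) [AddCommGroup M] [Module R M] [Module.Finite R M]
    (N : Type) [AddCommGroup N] [Module R N]
    (x : R) (hx : x ∈ maximalIdeal R) (hreg : IsSMulRegular M x)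
    (r s : ℕ) (hs : 0 < s) (hr : 0 < r) (hsr : s ≤ r)
    (hvanish : ∀ i : ℕ, r - s + 1 < i → Subsingleton (ext R i (QuotSMulTop x M) N))
    (hne : Nontrivial (ext R (r - s + 1) (QuotSMulTop x M) N))
    (hfg : ∀ i : ℕ, Module.Finite R (ext R i M N)) :
    (∀ i : ℕ, r - s < i → Subsingleton (ext R i M N)) ∧
      Nontrivial (ext R (r - s) M N) := by
  let e (L : ModuleCat.{0} R) (i : ℕ) :=
    (projectiveResolution L).extLinearEquiv (ModuleCat.of R N) R i
  have hreg' : IsSMulRegular (ModuleCat.of R M) x := hreg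
  have hvan (i : ℕ) (hi : r - s < i) :
      Subsingleton (Abelian.Ext (ModuleCat.of R M) (ModuleCat.of R N) i) :=
    hreg'.subsingleton_ext_of_succ hx (Module.Finite.equiv (e (.of R M) i))
      (have := hvanish (i + 1) (by lia)
      (e (.of R (QuotSMulTop x M)) (i + 1)).symm.injective.subsingleton)
  refine ⟨fun i hi ↦ ?_, ?_⟩
  · have := hvan i hi
    exact (e (.of R M) i).injective.subsingleton
  · have := hreg'.nontrivial_ext_of_succ (hvan (r - s + 1) (by lia))
      (e (.of R (QuotSMulTop x M)) (r - s + 1)).symm.surjective.nontrivial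
    exact (e (.of R M) (r - s)).surjective.nontrivial


end
end
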